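/- arXiv:1111.4173 — 2 statements merged into one kernel-verified Lean document; each statement's English description precedes it below -/
import Mathlib

section
/- For any smooth function X^i on E* (the spatial components of a d-vector field), the mixed Ricci identity holds: X^i_{/b|k} − X^i_{|k/b} = X^r R^i_rbk − X^i_{|r} T^r_bk − X^i|^(r)_(f) R^(f)_(r)bk, where T^r_bk = −A^r_bk, R^i_rbk = δA^i_rb/δx^k − δH^i_rk/δt^b + A^s_rb H^i_sk − H^s_rk A^i_sb + C^i(s)_r(f) R^(f)_(s)bk, and R^(f)_(r)bk = δN1^(f)_(r)b/δx^k − δN2^(f)_(r)k/δt^b. -/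
noncomputable section

/-- The dual 1-jet space `E* = ℝ^m × ℝ^n × ℝ^(n×m)`, with coordinates
`(t^a, x^i, p_i^a)`. -/
abbrev Es (m n : ℕ) : Type := (Fin m → ℝ) × (Fin n → ℝ) × (Fin n → Fin m → ℝ)

variable {m n : ℕ}

/-- Kronecker delta. -/
def kd {α : Type*} [DecidableEq α] (a b : α) : ℝ := if a = b then 1 else 0

/-- Partial derivative `∂/∂t^a` on `E*`. -/
def pt (a : Fin m) (F : Es m n → ℝ) (u : Es m n) : ℝ :=
  fderiv ℝ F u (Pi.single a 1, 0, 0)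

/-- Partial derivative `∂/∂x^i` on `E*`. -/
def px (i : Fin n) (F : Es m n → ℝ) (u : Es m n) : ℝ :=
  fderiv ℝ F u (0, Pi.single i 1, 0)

/-- Partial derivative `∂/∂p_i^a` on `E*`. -/
def pp (i : Fin n) (a : Fin m) (F : Es m n → ℝ) (u : Es m n) : ℝ :=
  fderiv ℝ F u (0, 0, Pi.single i (Pi.single a 1))

/-- Adapted derivative `δ/δt^a = ∂/∂t^a - N1^(b)_(j)a ∂/∂p_j^b` of the
nonlinear connection `N = (N1, N2)`; `N1 b j a` stands for `N1^(b)_(j)a`. -/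
def dt (N1 : Fin m → Fin n → Fin m → Es m n → ℝ) (a : Fin m) (F : Es m n → ℝ)
    (u : Es m n) : ℝ :=
  pt a F u - ∑ b, ∑ j, N1 b j a u * pp j b F u

/-- Adapted derivative `δ/δx^i = ∂/∂x^i - N2^(b)_(j)i ∂/∂p_j^b` of the
nonlinear connection `N = (N1, N2)`; `N2 b j i` stands for `N2^(b)_(j)i`. -/
def dx (N2 : Fin m → Fin n → Fin n → Es m n → ℝ) (i : Fin n) (F : Es m n → ℝ)
    (u : Es m n) : ℝ :=
  px i F u - ∑ b, ∑ j, N2 b j i u * pp j b F u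

/-- Partial derivative `∂/∂t^c` on the temporal factor `ℝ^m`. -/
def ptm (c : Fin m) (f : (Fin m → ℝ) → ℝ) (t : Fin m → ℝ) : ℝ :=
  fderiv ℝ f t (Pi.single c 1)

/-- Partial derivative `∂/∂x^k` on the spatial factor `ℝ^n`. -/
def pxn (k : Fin n) (f : (Fin n → ℝ) → ℝ) (x : Fin n → ℝ) : ℝ :=
  fderiv ℝ f x (Pi.single k 1)

/-! ### Christoffel symbols and their curvatures -/

/-- The Christoffel symbols of a (semi-Riemannian) metric `g` with inverse `ginv`
on `ℝ^k`: `γ^a_bc = (1/2) g^{ad} (∂g_db/∂t^c + ∂g_dc/∂t^b - ∂g_bc/∂t^d)`. -/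
def christoffel {k : ℕ} (g ginv : Fin k → Fin k → (Fin k → ℝ) → ℝ)
    (a b c : Fin k) (t : Fin k → ℝ) : ℝ :=
  (1 / 2) * ∑ d, ginv a d t *
    (ptm c (g d b) t + ptm b (g d c) t - ptm d (g b c) t)

/-- The curvature tensor of a family of Christoffel symbols `γ` on `ℝ^k`:
`γ^l_iab = ∂γ^l_ia/∂t^b - ∂γ^l_ib/∂t^a + γ^e_ia γ^l_eb - γ^e_ib γ^l_ea`. -/
def christoffelCurv {k : ℕ} (γ : Fin k → Fin k → Fin k → (Fin k → ℝ) → ℝ)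
    (l i a b : Fin k) (t : Fin k → ℝ) : ℝ :=
  ptm b (γ l i a) t - ptm a (γ l i b) t +
    ∑ e, (γ e i a t * γ l e b t - γ e i b t * γ l e a t)

/-! ### Torsion and curvature d-tensors of an h-normal N-linear connection
`(χ^a_bc, A^i_jc, H^i_jk, C^i(k)_j(c))` on `E*`.  Throughout, `A i j c` stands
for `A^i_jc`, `H i j k` for `H^i_jk` and `C i k j c` for `C^i(k)_j(c)`. -/

section Connection

variable (N1 : Fin m → Fin n → Fin m → Es m n → ℝ)
variable (N2 : Fin m → Fin n → Fin n → Es m n → ℝ)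
variable (χ : Fin m → Fin m → Fin m → (Fin m → ℝ) → ℝ)
variable (A : Fin n → Fin n → Fin m → Es m n → ℝ)
variable (H : Fin n → Fin n → Fin n → Es m n → ℝ)
variable (C : Fin n → Fin n → Fin n → Fin m → Es m n → ℝ)

/-- Torsion `R^(f)_(r)ab = δN1^(f)_(r)a/δt^b - δN1^(f)_(r)b/δt^a`. -/
def RR1 (f : Fin m) (r : Fin n) (a b : Fin m) (u : Es m n) : ℝ :=
  dt N1 b (N1 f r a) u - dt N1 a (N1 f r b) u

/-- Torsion `R^(f)_(r)aj = δN1^(f)_(r)a/δx^j - δN2^(f)_(r)j/δt^a`. -/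
def RRmix (f : Fin m) (r : Fin n) (a : Fin m) (j : Fin n) (u : Es m n) : ℝ :=
  dx N2 j (N1 f r a) u - dt N1 a (N2 f r j) u

/-- Torsion `R^(f)_(r)ij = δN2^(f)_(r)i/δx^j - δN2^(f)_(r)j/δx^i`. -/
def RR2 (f : Fin m) (r i j : Fin n) (u : Es m n) : ℝ :=
  dx N2 j (N2 f r i) u - dx N2 i (N2 f r j) u

/-- Torsion `P^(f)(j)_(r)a(b) = ∂N1^(f)_(r)a/∂p_j^b + δ^f_b A^j_ra - δ^j_r χ^f_ba`. -/
def Ptor1 (f : Fin m) (j : Fin n) (r : Fin n) (a b : Fin m) (u : Es m n) : ℝ :=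
  pp j b (N1 f r a) u + kd f b * A j r a u - kd j r * χ f b a u.1

/-- Torsion `P^(f)(j)_(r)i(b) = ∂N2^(f)_(r)i/∂p_j^b + δ^f_b H^j_ri`. -/
def Ptor2 (f : Fin m) (j r i : Fin n) (b : Fin m) (u : Es m n) : ℝ :=
  pp j b (N2 f r i) u + kd f b * H j r i u

/-- Torsion `S^(f)(j)(k)_(r)(b)(c) = -(δ^f_b C^j(k)_r(c) - δ^f_c C^k(j)_r(b))`. -/
def Stor (f : Fin m) (j k r : Fin n) (b c : Fin m) (u : Es m n) : ℝ :=
  -(kd f b * C j k r c u - kd f c * C k j r b u)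

/-- The `T`-horizontal covariant derivative `C^l(k)_i(c)/b` of `C`. -/
def CcovT (l k i : Fin n) (c : Fin m) (b : Fin m) (u : Es m n) : ℝ :=
  dt N1 b (C l k i c) u + ∑ s, C s k i c u * A l s b u -
    ∑ s, C l k s c u * A s i b u + ∑ s, C l s i c u * A k s b u -
    ∑ f, C l k i f u * χ f c b u.1

/-- The `M`-horizontal covariant derivative
`C^l(k)_i(c)|j = δC^l(k)_i(c)/δx^j + C^s(k)_i(c) H^l_sj - C^l(k)_s(c) H^s_ij
+ C^l(s)_i(c) H^k_sj` of `C`. -/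
def CcovX (l k i : Fin n) (c : Fin m) (j : Fin n) (u : Es m n) : ℝ :=
  dx N2 j (C l k i c) u + ∑ s, C s k i c u * H l s j u -
    ∑ s, C l k s c u * H s i j u + ∑ s, C l s i c u * H k s j u

/-- Curvature `R^l_ibc = δA^l_ib/δt^c - δA^l_ic/δt^b + A^r_ib A^l_rc
- A^r_ic A^l_rb + C^l(r)_i(f) R^(f)_(r)bc`. -/
def curvT (l i : Fin n) (b c : Fin m) (u : Es m n) : ℝ :=
  dt N1 c (A l i b) u - dt N1 b (A l i c) u +
    ∑ r, (A r i b u * A l r c u - A r i c u * A l r b u) +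
    ∑ r, ∑ f, C l r i f u * RR1 N1 f r b c u

/-- Curvature `R^l_ibk = δA^l_ib/δx^k - δH^l_ik/δt^b + A^r_ib H^l_rk
- H^r_ik A^l_rb + C^l(r)_i(f) R^(f)_(r)bk`. -/
def curvMix (l i : Fin n) (b : Fin m) (k : Fin n) (u : Es m n) : ℝ :=
  dx N2 k (A l i b) u - dt N1 b (H l i k) u +
    ∑ r, (A r i b u * H l r k u - H r i k u * A l r b u) +
    ∑ r, ∑ f, C l r i f u * RRmix N1 N2 f r b k u

/-- Curvature `R^l_ijk = δH^l_ij/δx^k - δH^l_ik/δx^j + H^r_ij H^l_rk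
- H^r_ik H^l_rj + C^l(r)_i(f) R^(f)_(r)jk`. -/
def curvH (l i j k : Fin n) (u : Es m n) : ℝ :=
  dx N2 k (H l i j) u - dx N2 j (H l i k) u +
    ∑ r, (H r i j u * H l r k u - H r i k u * H l r j u) +
    ∑ r, ∑ f, C l r i f u * RR2 N2 f r j k u

/-- Curvature `P^l(k)_ib(c) = ∂A^l_ib/∂p_k^c - C^l(k)_i(c)/b
+ C^l(r)_i(f) P^(f)(k)_(r)b(c)`. -/
def curvP1 (l i : Fin n) (b : Fin m) (k : Fin n) (c : Fin m) (u : Es m n) : ℝ :=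
  pp k c (A l i b) u - CcovT N1 χ A C l k i c b u +
    ∑ r, ∑ f, C l r i f u * Ptor1 N1 χ A f k r b c u

/-- Curvature `P^l(k)_ij(c) = ∂H^l_ij/∂p_k^c - C^l(k)_i(c)|j
+ C^l(r)_i(f) P^(f)(k)_(r)j(c)`. -/
def curvP2 (l i j k : Fin n) (c : Fin m) (u : Es m n) : ℝ :=
  pp k c (H l i j) u - CcovX N2 H C l k i c j u +
    ∑ r, ∑ f, C l r i f u * Ptor2 N2 H f k r j c u

/-- Curvature `S^l(j)(k)_i(b)(c) = ∂C^l(j)_i(b)/∂p_k^c - ∂C^l(k)_i(c)/∂p_j^b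
+ C^r(j)_i(b) C^l(k)_r(c) - C^r(k)_i(c) C^l(j)_r(b)`. -/
def curvS (l j k i : Fin n) (b c : Fin m) (u : Es m n) : ℝ :=
  pp k c (C l j i b) u - pp j b (C l k i c) u +
    ∑ r, (C r j i b u * C l k r c u - C r k i c u * C l j r b u)

end Connection

section Ricci11

variable (N1 : Fin m → Fin n → Fin m → Es m n → ℝ)
variable (N2 : Fin m → Fin n → Fin n → Es m n → ℝ)
variable (A : Fin n → Fin n → Fin m → Es m n → ℝ)
variable (H : Fin n → Fin n → Fin n → Es m n → ℝ)
variable (C : Fin n → Fin n → Fin n → Fin m → Es m n → ℝ)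

/-- `T`-horizontal covariant derivative `X^i_{/b} = δX^i/δt^b + X^j A^i_jb`. -/
def covTs (X : Fin n → Es m n → ℝ) (i : Fin n) (b : Fin m) (u : Es m n) : ℝ :=
  dt N1 b (X i) u + ∑ j, X j u * A i j b u

/-- `M`-horizontal covariant derivative `X^i_{|k} = δX^i/δx^k + X^j H^i_jk`. -/
def covXs (X : Fin n → Es m n → ℝ) (i k : Fin n) (u : Es m n) : ℝ :=
  dx N2 k (X i) u + ∑ j, X j u * H i j k u

/-- Mixed second covariant derivative
`X^i_{/b|k} = δ(X^i_{/b})/δx^k + X^r_{/b} H^i_rk`. -/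
def covTsX (X : Fin n → Es m n → ℝ) (i : Fin n) (b : Fin m) (k : Fin n)
    (u : Es m n) : ℝ :=
  dx N2 k (fun v => covTs N1 A X i b v) u + ∑ r, covTs N1 A X r b u * H i r k u

/-- Mixed second covariant derivative
`X^i_{|k/b} = δ(X^i_{|k})/δt^b + X^r_{|k} A^i_rb - X^i_{|r} A^r_kb`. -/
def covXsT (X : Fin n → Es m n → ℝ) (i k : Fin n) (b : Fin m) (u : Es m n) : ℝ :=
  dt N1 b (fun v => covXs N2 H X i k v) u + ∑ r, covXs N2 H X r k u * A i r b u -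
    ∑ r, covXs N2 H X i r u * A r k b u

/-- Vertical covariant derivative `X^i|^(r)_(f) = ∂X^i/∂p_r^f + X^j C^i(r)_j(f)`. -/
def vertXs (X : Fin n → Es m n → ℝ) (i r : Fin n) (f : Fin m) (u : Es m n) : ℝ :=
  pp r f (X i) u + ∑ j, X j u * C i r j f u

end Ricci11

/-- A vertical direction expands in the basis `∂/∂p`. -/
lemma fderiv_vert (L : Es m n →L[ℝ] ℝ) (q : Fin n → Fin m → ℝ) :
    L (0, 0, q) = ∑ b, ∑ j, q j b * L (0, 0, Pi.single j (Pi.single b 1)) := by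
  have hq : ((0, 0, q) : Es m n) =
      ∑ b, ∑ j, q j b • ((0, 0, Pi.single j (Pi.single b 1)) : Es m n) := by
    refine Prod.ext ?_ (Prod.ext ?_ ?_)
    · simp [Prod.fst_sum]
    · simp [Prod.fst_sum, Prod.snd_sum]
    · funext j b
      simp [Prod.snd_sum, Finset.sum_apply, Pi.single_apply]
  rw [hq]
  simp only [map_sum, map_smul, smul_eq_mul]

/-- The vector field `δ/δt^a`. -/
def Vt (N1 : Fin m → Fin n → Fin m → Es m n → ℝ) (a : Fin m) (u : Es m n) : Es m n :=
  (Pi.single a 1, 0, fun j b => -N1 b j a u)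

/-- The vector field `δ/δx^i`. -/
def Vx (N2 : Fin m → Fin n → Fin n → Es m n → ℝ) (i : Fin n) (u : Es m n) : Es m n :=
  (0, Pi.single i 1, fun j b => -N2 b j i u)

lemma dt_eq (N1 : Fin m → Fin n → Fin m → Es m n → ℝ) (a : Fin m) (F : Es m n → ℝ)
    (u : Es m n) : dt N1 a F u = fderiv ℝ F u (Vt N1 a u) := by
  have hs : Vt N1 a u = (Pi.single a 1, 0, 0) + (0, 0, fun j b => -N1 b j a u) := by
    simp [Vt]
  rw [hs, map_add, fderiv_vert]
  simp [dt, pt, pp, sub_eq_add_neg]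

lemma dx_eq (N2 : Fin m → Fin n → Fin n → Es m n → ℝ) (i : Fin n) (F : Es m n → ℝ)
    (u : Es m n) : dx N2 i F u = fderiv ℝ F u (Vx N2 i u) := by
  have hs : Vx N2 i u = (0, Pi.single i 1, 0) + (0, 0, fun j b => -N2 b j i u) := by
    simp [Vx]
  rw [hs, map_add, fderiv_vert]
  simp [dx, px, pp, sub_eq_add_neg]

lemma hasFDerivAt_Vt (N1 : Fin m → Fin n → Fin m → Es m n → ℝ)
    (hN1 : ∀ e r a, ContDiff ℝ (⊤ : ℕ∞) (N1 e r a)) (a : Fin m) (u : Es m n) :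
    DifferentiableAt ℝ (Vt N1 a) u ∧
      ∀ w, fderiv ℝ (Vt N1 a) u w = (0, 0, fun j b => -fderiv ℝ (N1 b j a) u w) := by
  have h3 : HasFDerivAt (fun v => fun (j : Fin n) (b : Fin m) => -N1 b j a v)
      (ContinuousLinearMap.pi fun j => ContinuousLinearMap.pi fun b =>
        -fderiv ℝ (N1 b j a) u) u := by
    refine hasFDerivAt_pi.2 fun j => hasFDerivAt_pi.2 fun b => ?_
    exact (((hN1 b j a).differentiable (by simp)) u).hasFDerivAt.neg
  have h := (hasFDerivAt_const (𝕜 := ℝ) (Pi.single a 1 : Fin m → ℝ) u).prodMk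
    ((hasFDerivAt_const (𝕜 := ℝ) (0 : Fin n → ℝ) u).prodMk h3)
  have h' : HasFDerivAt (Vt N1 a) _ u := h
  refine ⟨h'.differentiableAt, fun w => ?_⟩
  rw [h'.fderiv]
  rfl

lemma hasFDerivAt_Vx (N2 : Fin m → Fin n → Fin n → Es m n → ℝ)
    (hN2 : ∀ e r i, ContDiff ℝ (⊤ : ℕ∞) (N2 e r i)) (i : Fin n) (u : Es m n) :
    DifferentiableAt ℝ (Vx N2 i) u ∧
      ∀ w, fderiv ℝ (Vx N2 i) u w = (0, 0, fun j b => -fderiv ℝ (N2 b j i) u w) := by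
  have h3 : HasFDerivAt (fun v => fun (j : Fin n) (b : Fin m) => -N2 b j i v)
      (ContinuousLinearMap.pi fun j => ContinuousLinearMap.pi fun b =>
        -fderiv ℝ (N2 b j i) u) u := by
    refine hasFDerivAt_pi.2 fun j => hasFDerivAt_pi.2 fun b => ?_
    exact (((hN2 b j i).differentiable (by simp)) u).hasFDerivAt.neg
  have h := (hasFDerivAt_const (𝕜 := ℝ) (0 : Fin m → ℝ) u).prodMk
    ((hasFDerivAt_const (𝕜 := ℝ) (Pi.single i 1 : Fin n → ℝ) u).prodMk h3)
  have h' : HasFDerivAt (Vx N2 i) _ u := h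
  refine ⟨h'.differentiableAt, fun w => ?_⟩
  rw [h'.fderiv]
  rfl

lemma diff_fderiv (F : Es m n → ℝ) (hF : ContDiff ℝ (⊤ : ℕ∞) F) (u : Es m n) :
    DifferentiableAt ℝ (fderiv ℝ F) u :=
  ((hF.fderiv_right (m := 1) (by norm_cast)).differentiable (by simp)) u

lemma diff_dt (N1 : Fin m → Fin n → Fin m → Es m n → ℝ)
    (hN1 : ∀ e r a, ContDiff ℝ (⊤ : ℕ∞) (N1 e r a)) (a : Fin m)
    (F : Es m n → ℝ) (hF : ContDiff ℝ (⊤ : ℕ∞) F) (u : Es m n) :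
    DifferentiableAt ℝ (fun v => dt N1 a F v) u := by
  simp only [dt_eq]
  exact (diff_fderiv F hF u).clm_apply (hasFDerivAt_Vt N1 hN1 a u).1

lemma diff_dx (N2 : Fin m → Fin n → Fin n → Es m n → ℝ)
    (hN2 : ∀ e r i, ContDiff ℝ (⊤ : ℕ∞) (N2 e r i)) (i : Fin n)
    (F : Es m n → ℝ) (hF : ContDiff ℝ (⊤ : ℕ∞) F) (u : Es m n) :
    DifferentiableAt ℝ (fun v => dx N2 i F v) u := by
  simp only [dx_eq]
  exact (diff_fderiv F hF u).clm_apply (hasFDerivAt_Vx N2 hN2 i u).1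

/-- The commutator `[δ/δx^k, δ/δt^b] = - R^(f)_(r)bk ∂/∂p_r^f`. -/
lemma comm_dx_dt (N1 : Fin m → Fin n → Fin m → Es m n → ℝ)
    (N2 : Fin m → Fin n → Fin n → Es m n → ℝ)
    (hN1 : ∀ e r a, ContDiff ℝ (⊤ : ℕ∞) (N1 e r a))
    (hN2 : ∀ e r i, ContDiff ℝ (⊤ : ℕ∞) (N2 e r i))
    (F : Es m n → ℝ) (hF : ContDiff ℝ (⊤ : ℕ∞) F) (u : Es m n) (k : Fin n) (b : Fin m) :
    dx N2 k (fun v => dt N1 b F v) u - dt N1 b (fun v => dx N2 k F v) u =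
      - ∑ f, ∑ r, pp r f F u * RRmix N1 N2 f r b k u := by
  simp only [RRmix, dt_eq, dx_eq]
  obtain ⟨ht, ht'⟩ := hasFDerivAt_Vt N1 hN1 b u
  obtain ⟨hx, hx'⟩ := hasFDerivAt_Vx N2 hN2 k u
  have hsymm : fderiv ℝ (fderiv ℝ F) u (Vx N2 k u) (Vt N1 b u) =
      fderiv ℝ (fderiv ℝ F) u (Vt N1 b u) (Vx N2 k u) :=
    (hF.contDiffAt.isSymmSndFDerivAt (by simp; norm_cast)) _ _
  rw [fderiv_clm_apply (diff_fderiv F hF u) ht, fderiv_clm_apply (diff_fderiv F hF u) hx]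
  simp only [ContinuousLinearMap.add_apply, ContinuousLinearMap.comp_apply,
    ContinuousLinearMap.flip_apply, ht', hx']
  rw [hsymm, fderiv_vert, fderiv_vert (fderiv ℝ F u)]
  simp only [pp, mul_sub, Finset.sum_sub_distrib, neg_mul, Finset.sum_neg_distrib]
  simp only [mul_comm]
  ring

/-- Leibniz rule for `fderiv` of `G + ∑ X_j Y_j`. -/
lemma fderiv_leib (G : Es m n → ℝ) (X Y : Fin n → Es m n → ℝ) (u w : Es m n)
    (hG : DifferentiableAt ℝ G u) (hX : ∀ j, DifferentiableAt ℝ (X j) u)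
    (hY : ∀ j, DifferentiableAt ℝ (Y j) u) :
    fderiv ℝ (fun v => G v + ∑ j, X j v * Y j v) u w =
      fderiv ℝ G u w + ∑ j, (fderiv ℝ (X j) u w * Y j u + X j u * fderiv ℝ (Y j) u w) := by
  have h := hG.hasFDerivAt.add (HasFDerivAt.fun_sum (u := Finset.univ) fun j _ =>
    (hX j).hasFDerivAt.mul (hY j).hasFDerivAt)
  have h' : HasFDerivAt (fun v => G v + ∑ j, X j v * Y j v) _ u := h
  rw [h'.fderiv]
  simp only [ContinuousLinearMap.add_apply, ContinuousLinearMap.sum_apply,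
    ContinuousLinearMap.smul_apply, smul_eq_mul]
  congr 1
  refine Finset.sum_congr rfl fun j _ => ?_
  ring

/-- For any smooth `X^i` on `E*`, the mixed Ricci identity of an
`h`-normal `N`-linear connection of Cartan type holds:
`X^i_{/b|k} - X^i_{|k/b} = X^r R^i_rbk - X^i_{|r} T^r_bk - X^i|^(r)_(f) R^(f)_(r)bk`,
where `T^r_bk = -A^r_bk`. -/
theorem mixed_Ricci_identity (m n : ℕ) (hm : 1 ≤ m) (hn : 1 ≤ n)
    -- the temporal metric `h`, its inverse, and its Christoffel symbols `χ`
    (h hinv : Fin m → Fin m → (Fin m → ℝ) → ℝ)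
    (hsmooth : ∀ a b, ContDiff ℝ (⊤ : ℕ∞) (h a b)) (hinvsmooth : ∀ a b, ContDiff ℝ (⊤ : ℕ∞) (hinv a b))
    (hsym : ∀ t a b, h a b t = h b a t)
    (hinverse : ∀ t a b, ∑ f, hinv a f t * h f b t = kd a b)
    (χ : Fin m → Fin m → Fin m → (Fin m → ℝ) → ℝ)
    (hχ : ∀ a b c t, χ a b c t = christoffel h hinv a b c t)
    -- the nonlinear connection `N = (N1, N2)`
    (N1 : Fin m → Fin n → Fin m → Es m n → ℝ)
    (N2 : Fin m → Fin n → Fin n → Es m n → ℝ)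
    (hN1 : ∀ e r a, ContDiff ℝ (⊤ : ℕ∞) (N1 e r a)) (hN2 : ∀ e r i, ContDiff ℝ (⊤ : ℕ∞) (N2 e r i))
    -- the remaining components `A^i_jc`, `H^i_jk`, `C^i(k)_j(c)` of the
    -- `h`-normal `N`-linear connection of Cartan type `CDΓ(N)`
    (A : Fin n → Fin n → Fin m → Es m n → ℝ)
    (H : Fin n → Fin n → Fin n → Es m n → ℝ)
    (C : Fin n → Fin n → Fin n → Fin m → Es m n → ℝ)
    (hAs : ∀ i j c, ContDiff ℝ (⊤ : ℕ∞) (A i j c)) (hHs : ∀ i j k, ContDiff ℝ (⊤ : ℕ∞) (H i j k))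
    (hCs : ∀ i k j c, ContDiff ℝ (⊤ : ℕ∞) (C i k j c))
    (hHsym : ∀ i j k (u : Es m n), H i j k u = H i k j u)
    (hCsym : ∀ i k j c (u : Es m n), C i k j c u = C k i j c u)
    -- the spatial components of a d-vector field
    (X : Fin n → Es m n → ℝ) (hX : ∀ i, ContDiff ℝ (⊤ : ℕ∞) (X i)) :
    ∀ (u : Es m n) (i k : Fin n) (b : Fin m),
      covTsX N1 N2 A H X i b k u - covXsT N1 N2 A H X i k b u =
        (∑ r, X r u * curvMix N1 N2 A H C i r b k u) -
          (∑ r, covXs N2 H X i r u * (-(A r k b u))) -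
          ∑ f, ∑ r, vertXs C X i r f u * RRmix N1 N2 f r b k u := by
  intro u i k b
  have dX : ∀ j, DifferentiableAt ℝ (X j) u := fun j => (hX j).differentiable (by simp) u
  have hT : dx N2 k (fun v => covTs N1 A X i b v) u =
      dx N2 k (fun v => dt N1 b (X i) v) u +
        ∑ j, (dx N2 k (X j) u * A i j b u + X j u * dx N2 k (A i j b) u) := by
    simp only [covTs, dx_eq]
    exact fderiv_leib _ X (fun j => A i j b) u _ (diff_dt N1 hN1 b (X i) (hX i) u) dX
      fun j => (hAs i j b).differentiable (by simp) u
  have hM : dt N1 b (fun v => covXs N2 H X i k v) u =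
      dt N1 b (fun v => dx N2 k (X i) v) u +
        ∑ j, (dt N1 b (X j) u * H i j k u + X j u * dt N1 b (H i j k) u) := by
    simp only [covXs, dt_eq]
    exact fderiv_leib _ X (fun j => H i j k) u _ (diff_dx N2 hN2 k (X i) (hX i) u) dX
      fun j => (hHs i j k).differentiable (by simp) u
  have hc := comm_dx_dt N1 N2 hN1 hN2 (X i) (hX i) u k b
  have e1 : ∑ r, ∑ j, X j u * A r j b u * H i r k u =
      ∑ r, ∑ j, X r u * (A j r b u * H i j k u) := by
    rw [Finset.sum_comm]
    simp only [mul_assoc]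
  have e2 : ∑ r, ∑ j, X j u * H r j k u * A i r b u =
      ∑ r, ∑ j, X r u * (H j r k u * A i j b u) := by
    rw [Finset.sum_comm]
    simp only [mul_assoc]
  have e3 : ∑ f, ∑ r, ∑ j, X j u * C i r j f u * RRmix N1 N2 f r b k u =
      ∑ j, ∑ r, ∑ f, X j u * (C i r j f u * RRmix N1 N2 f r b k u) := by
    simp only [mul_assoc]
    rw [Finset.sum_comm]
    conv_rhs => rw [Finset.sum_comm]
    refine Finset.sum_congr rfl fun r _ => ?_
    rw [Finset.sum_comm]
  have hc' := sub_eq_iff_eq_add.1 hc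
  simp only [covTsX, covXsT]
  rw [hT, hM, hc']
  have x1 : ∑ r, covTs N1 A X r b u * H i r k u = ∑ r, dt N1 b (X r) u * H i r k u +
      ∑ r, ∑ j, X j u * A r j b u * H i r k u := by
    simp only [covTs, add_mul, Finset.sum_mul, Finset.sum_add_distrib]
  have x2 : ∑ r, covXs N2 H X r k u * A i r b u = ∑ r, dx N2 k (X r) u * A i r b u +
      ∑ r, ∑ j, X j u * H r j k u * A i r b u := by
    simp only [covXs, add_mul, Finset.sum_mul, Finset.sum_add_distrib]
  have x3 : ∑ f, ∑ r, vertXs C X i r f u * RRmix N1 N2 f r b k u =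
      ∑ f, ∑ r, pp r f (X i) u * RRmix N1 N2 f r b k u +
      ∑ f, ∑ r, ∑ j, X j u * C i r j f u * RRmix N1 N2 f r b k u := by
    simp only [vertXs, add_mul, Finset.sum_mul, Finset.sum_add_distrib]
  have x4 : ∑ r, X r u * curvMix N1 N2 A H C i r b k u =
      ∑ r, X r u * dx N2 k (A i r b) u - ∑ r, X r u * dt N1 b (H i r k) u +
      (∑ r, ∑ j, X r u * (A j r b u * H i j k u) -
        ∑ r, ∑ j, X r u * (H j r k u * A i j b u)) +
      ∑ j, ∑ r, ∑ f, X j u * (C i r j f u * RRmix N1 N2 f r b k u) := by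
    simp only [curvMix, mul_add, mul_sub, Finset.mul_sum, Finset.sum_add_distrib,
      Finset.sum_sub_distrib]
  rw [x1, x2, x3, x4, e1, e2, e3]
  simp only [Finset.sum_add_distrib, mul_neg, Finset.sum_neg_distrib]
  ring
end
end

section
/- For an h-normal N-linear connection of Cartan type, the eleventh-set Bianchi identity holds: the cyclic sum over the three index pairs ((i),(a)), ((j),(b)), ((k),(c)) of { S^l(i)(j)_p(a)(b)|^(k)_(c) + S^(r)(i)(j)_(f)(a)(b) S^l(k)(f)_p(c)(r) } vanishes, where S^l(i)(j)_p(a)(b) = ∂C^l(i)_p(a)/∂p_j^b − ∂C^l(j)_p(b)/∂p_i^a + C^r(i)_p(a) C^l(j)_r(b) − C^r(j)_p(b) C^l(i)_r(a) and S^(r)(i)(j)_(f)(a)(b) = −(δ^r_a C^i(j)_f(b) − δ^r_b C^j(i)_f(a)). -/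
noncomputable section

variable {m n : ℕ}

section Bianchi19

variable (C : Fin n → Fin n → Fin n → Fin m → Es m n → ℝ)

/-- Vertical covariant derivative of the curvature d-tensor `S`:
`S^l(i)(j)_p(a)(b)|^(k)_(c) = ∂S^l(i)(j)_p(a)(b)/∂p_k^c
+ S^r(i)(j)_p(a)(b) C^l(k)_r(c) - S^l(i)(j)_r(a)(b) C^r(k)_p(c)
+ S^l(r)(j)_p(a)(b) C^i(k)_r(c) + S^l(i)(r)_p(a)(b) C^j(k)_r(c)`. -/
def ScurvV (l i j p : Fin n) (a b : Fin m) (k : Fin n) (c : Fin m)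
    (u : Es m n) : ℝ :=
  pp k c (fun v => curvS C l i j p a b v) u +
    ∑ r, curvS C r i j p a b u * C l k r c u -
    ∑ r, curvS C l i j r a b u * C r k p c u +
    ∑ r, curvS C l r j p a b u * C i k r c u +
    ∑ r, curvS C l i r p a b u * C j k r c u

end Bianchi19

lemma pp_diff {m n : ℕ} (j : Fin n) (b : Fin m) {F : Es m n → ℝ}
    (hF : ContDiff ℝ (⊤ : ℕ∞) F) : ContDiff ℝ (⊤ : ℕ∞) (pp j b F) := by
  unfold pp
  exact (hF.fderiv_right (m := (⊤ : ℕ∞)) (by simp)).clm_apply contDiff_const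

lemma pp_comm {m n : ℕ} (i j : Fin n) (a b : Fin m) {F : Es m n → ℝ}
    (hF : ContDiff ℝ (⊤ : ℕ∞) F) (u : Es m n) :
    pp i a (pp j b F) u = pp j b (pp i a F) u := by
  have hd : DifferentiableAt ℝ (fderiv ℝ F) u :=
    ((hF.fderiv_right (m := (⊤ : ℕ∞)) (by simp)).differentiable (by simp)) u
  have hs : IsSymmSndFDerivAt ℝ F u := by
    apply hF.contDiffAt.isSymmSndFDerivAt
    simp
    exact WithTop.coe_le_coe.2 (le_top : (2 : ℕ∞) ≤ ⊤)
  unfold pp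
  rw [fderiv_clm_apply hd (differentiableAt_const _),
    fderiv_clm_apply hd (differentiableAt_const _)]
  simpa using hs _ _

lemma pp_curvS {m n : ℕ} (C : Fin n → Fin n → Fin n → Fin m → Es m n → ℝ)
    (hCs : ∀ i k j c, ContDiff ℝ (⊤ : ℕ∞) (C i k j c))
    (l i j p k : Fin n) (a b c : Fin m) (u : Es m n) :
    pp k c (fun v => curvS C l i j p a b v) u =
      pp k c (pp j b (C l i p a)) u - pp k c (pp i a (C l j p b)) u +
      (∑ r, C l j r b u * pp k c (C r i p a) u + ∑ r, pp k c (C l j r b) u * C r i p a u -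
       ∑ r, C l i r a u * pp k c (C r j p b) u - ∑ r, pp k c (C l i r a) u * C r j p b u) := by
  have d1 : ∀ i k j c, HasFDerivAt (C i k j c) (fderiv ℝ (C i k j c) u) u := fun i k j c =>
    ((hCs i k j c).differentiable (by simp) u).hasFDerivAt
  have d2 : ∀ q e i k j c, HasFDerivAt (pp q e (C i k j c)) (fderiv ℝ (pp q e (C i k j c)) u) u :=
    fun q e i k j c => ((pp_diff q e (hCs i k j c)).differentiable (by simp) u).hasFDerivAt
  have key := ((d2 j b l i p a).sub (d2 i a l j p b)).add
    (HasFDerivAt.fun_sum (u := Finset.univ) (fun r _ =>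
      ((d1 r i p a).mul (d1 l j r b)).sub ((d1 r j p b).mul (d1 l i r a))))
  have e : pp k c (fun v => curvS C l i j p a b v) u = _ :=
    congrArg (fun L => L (0, 0, Pi.single k (Pi.single c 1))) key.fderiv
  rw [e]
  simp only [ContinuousLinearMap.add_apply, ContinuousLinearMap.sub_apply,
    ContinuousLinearMap.sum_apply, ContinuousLinearMap.smul_apply, smul_eq_mul,
    ← Finset.sum_add_distrib, ← Finset.sum_sub_distrib]
  unfold pp
  congr 1
  refine Finset.sum_congr rfl fun r _ => ?_
  ring

lemma curvS_anti {m n : ℕ} (C : Fin n → Fin n → Fin n → Fin m → Es m n → ℝ)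
    (l i j p : Fin n) (a b : Fin m) (u : Es m n) :
    curvS C l i j p a b u = - curvS C l j i p b a u := by
  have : ∀ r, (C r i p a u * C l j r b u - C r j p b u * C l i r a u) =
    - (C r j p b u * C l i r a u - C r i p a u * C l j r b u) := fun r => by ring
  unfold curvS
  simp only [this, Finset.sum_neg_distrib]
  ring

lemma Stor_sum {m n : ℕ} (C : Fin n → Fin n → Fin n → Fin m → Es m n → ℝ)
    (l i j p k : Fin n) (a b c : Fin m) (u : Es m n) :
    ∑ r, ∑ f, Stor C r i j f a b u * curvS C l k f p c r u =
      ∑ f, curvS C l k f p c b u * C j i f a u + ∑ f, curvS C l f k p a c u * C i j f b u := by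
  rw [Finset.sum_comm, ← Finset.sum_add_distrib]
  refine Finset.sum_congr rfl fun f _ => ?_
  simp only [Stor, kd, neg_sub, sub_mul, ite_mul, one_mul, zero_mul, Finset.sum_sub_distrib,
    Finset.sum_ite_eq', Finset.mem_univ, if_true]
  rw [curvS_anti C l f k]
  ring

/-- The matrix of `curvS`. -/
lemma curvS_matrix {m n : ℕ} (C : Fin n → Fin n → Fin n → Fin m → Es m n → ℝ)
    (i j : Fin n) (a b : Fin m) (u : Es m n) :
    (Matrix.of fun l p => curvS C l i j p a b u) =
      (Matrix.of fun l p => pp j b (C l i p a) u) - (Matrix.of fun l p => pp i a (C l j p b) u) +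
      (Matrix.of fun l p => C l j p b u) * (Matrix.of fun l p => C l i p a u) -
      (Matrix.of fun l p => C l i p a u) * (Matrix.of fun l p => C l j p b u) := by
  ext l p
  simp only [curvS, Matrix.of_apply, Matrix.add_apply, Matrix.sub_apply, Matrix.mul_apply,
    Finset.sum_sub_distrib]
  simp only [mul_comm]
  ring

lemma cov_matrix {m n : ℕ} (C : Fin n → Fin n → Fin n → Fin m → Es m n → ℝ)
    (hCs : ∀ i k j c, ContDiff ℝ (⊤ : ℕ∞) (C i k j c))
    (l i j p k : Fin n) (a b c : Fin m) (u : Es m n) :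
    pp k c (fun v => curvS C l i j p a b v) u + ∑ r, curvS C r i j p a b u * C l k r c u -
      ∑ r, curvS C l i j r a b u * C r k p c u =
    ((Matrix.of fun l p => pp k c (pp j b (C l i p a)) u) -
      (Matrix.of fun l p => pp k c (pp i a (C l j p b)) u) +
      ((Matrix.of fun l p => C l j p b u) * (Matrix.of fun l p => pp k c (C l i p a) u) +
       (Matrix.of fun l p => pp k c (C l j p b) u) * (Matrix.of fun l p => C l i p a u) -
       (Matrix.of fun l p => C l i p a u) * (Matrix.of fun l p => pp k c (C l j p b) u) -
       (Matrix.of fun l p => pp k c (C l i p a) u) * (Matrix.of fun l p => C l j p b u)) +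
      (Matrix.of fun l p => C l k p c u) * (Matrix.of fun l p => curvS C l i j p a b u) -
      (Matrix.of fun l p => curvS C l i j p a b u) * (Matrix.of fun l p => C l k p c u)) l p := by
  rw [pp_curvS C hCs]
  simp only [Matrix.of_apply, Matrix.add_apply, Matrix.sub_apply, Matrix.mul_apply]
  rw [Finset.sum_congr rfl fun r _ => mul_comm (curvS C r i j p a b u) _]

lemma cov_cyclic {m n : ℕ} (C : Fin n → Fin n → Fin n → Fin m → Es m n → ℝ)
    (hCs : ∀ i k j c, ContDiff ℝ (⊤ : ℕ∞) (C i k j c))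
    (l i j p k : Fin n) (a b c : Fin m) (u : Es m n) :
    (pp k c (fun v => curvS C l i j p a b v) u + ∑ r, curvS C r i j p a b u * C l k r c u -
      ∑ r, curvS C l i j r a b u * C r k p c u) +
    (pp i a (fun v => curvS C l j k p b c v) u + ∑ r, curvS C r j k p b c u * C l i r a u -
      ∑ r, curvS C l j k r b c u * C r i p a u) +
    (pp j b (fun v => curvS C l k i p c a v) u + ∑ r, curvS C r k i p c a u * C l j r b u -
      ∑ r, curvS C l k i r c a u * C r j p b u) = 0 := by
  rw [cov_matrix C hCs, cov_matrix C hCs, cov_matrix C hCs, ← Matrix.add_apply, ← Matrix.add_apply]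
  simp only [curvS_matrix]
  have s1 : ∀ l p, pp k c (pp j b (C l i p a)) u = pp j b (pp k c (C l i p a)) u :=
    fun l p => pp_comm _ _ _ _ (hCs _ _ _ _) u
  have s2 : ∀ l p, pp k c (pp i a (C l j p b)) u = pp i a (pp k c (C l j p b)) u :=
    fun l p => pp_comm _ _ _ _ (hCs _ _ _ _) u
  have s3 : ∀ l p, pp i a (pp j b (C l k p c)) u = pp j b (pp i a (C l k p c)) u :=
    fun l p => pp_comm _ _ _ _ (hCs _ _ _ _) u
  simp only [s1, s2, s3]
  rw [show (0 : ℝ) = (0 : Matrix (Fin n) (Fin n) ℝ) l p from rfl]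
  refine congrFun (congrFun ?_ l) p
  noncomm_ring

/-- For an `h`-normal `N`-linear connection of Cartan type, the
eleventh-set Bianchi identity holds: the cyclic sum over the three index pairs
`((i),(a))`, `((j),(b))`, `((k),(c))` of
`{ S^l(i)(j)_p(a)(b)|^(k)_(c) + S^(r)(i)(j)_(f)(a)(b) S^l(k)(f)_p(c)(r) }` vanishes. -/
theorem Bianchi_eleventh_set (m n : ℕ) (hm : 1 ≤ m) (hn : 1 ≤ n)
    -- the temporal metric `h`, its inverse, and its Christoffel symbols `χ`
    (h hinv : Fin m → Fin m → (Fin m → ℝ) → ℝ)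
    (hsmooth : ∀ a b, ContDiff ℝ (⊤ : ℕ∞) (h a b)) (hinvsmooth : ∀ a b, ContDiff ℝ (⊤ : ℕ∞) (hinv a b))
    (hsym : ∀ t a b, h a b t = h b a t)
    (hinverse : ∀ t a b, ∑ f, hinv a f t * h f b t = kd a b)
    (χ : Fin m → Fin m → Fin m → (Fin m → ℝ) → ℝ)
    (hχ : ∀ a b c t, χ a b c t = christoffel h hinv a b c t)
    -- the nonlinear connection `N = (N1, N2)`
    (N1 : Fin m → Fin n → Fin m → Es m n → ℝ)
    (N2 : Fin m → Fin n → Fin n → Es m n → ℝ)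
    (hN1 : ∀ e r a, ContDiff ℝ (⊤ : ℕ∞) (N1 e r a)) (hN2 : ∀ e r i, ContDiff ℝ (⊤ : ℕ∞) (N2 e r i))
    -- the remaining components `A^i_jc`, `H^i_jk`, `C^i(k)_j(c)` of the
    -- `h`-normal `N`-linear connection of Cartan type `CDΓ(N)`
    (A : Fin n → Fin n → Fin m → Es m n → ℝ)
    (H : Fin n → Fin n → Fin n → Es m n → ℝ)
    (C : Fin n → Fin n → Fin n → Fin m → Es m n → ℝ)
    (hAs : ∀ i j c, ContDiff ℝ (⊤ : ℕ∞) (A i j c)) (hHs : ∀ i j k, ContDiff ℝ (⊤ : ℕ∞) (H i j k))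
    (hCs : ∀ i k j c, ContDiff ℝ (⊤ : ℕ∞) (C i k j c))
    (hHsym : ∀ i j k (u : Es m n), H i j k u = H i k j u)
    (hCsym : ∀ i k j c (u : Es m n), C i k j c u = C k i j c u)
    : ∀ (u : Es m n) (l p i j k : Fin n) (a b c : Fin m),
      (ScurvV C l i j p a b k c u +
        ∑ r, ∑ f, Stor C r i j f a b u * curvS C l k f p c r u) +
      (ScurvV C l j k p b c i a u +
        ∑ r, ∑ f, Stor C r j k f b c u * curvS C l i f p a r u) +
      (ScurvV C l k i p c a j b u +
        ∑ r, ∑ f, Stor C r k i f c a u * curvS C l j f p b r u) = 0 := by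
  intro u l p i j k a b c
  have key := cov_cyclic C hCs l i j p k a b c u
  simp only [Stor_sum]
  unfold ScurvV
  have f1 := Finset.sum_congr (rfl : (Finset.univ : Finset (Fin n)) = _) fun r _ =>
    congrArg (· * C i k r c u) (curvS_anti C l r j p a b u)
  have f2 := Finset.sum_congr (rfl : (Finset.univ : Finset (Fin n)) = _) fun r _ =>
    congrArg (· * C j k r c u) (curvS_anti C l i r p a b u)
  have f3 := Finset.sum_congr (rfl : (Finset.univ : Finset (Fin n)) = _) fun r _ =>
    congrArg (· * C j i r a u) (curvS_anti C l r k p b c u)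
  have f4 := Finset.sum_congr (rfl : (Finset.univ : Finset (Fin n)) = _) fun r _ =>
    congrArg (· * C k i r a u) (curvS_anti C l j r p b c u)
  have f5 := Finset.sum_congr (rfl : (Finset.univ : Finset (Fin n)) = _) fun r _ =>
    congrArg (· * C k j r b u) (curvS_anti C l r i p c a u)
  have f6 := Finset.sum_congr (rfl : (Finset.univ : Finset (Fin n)) = _) fun r _ =>
    congrArg (· * C i j r b u) (curvS_anti C l k r p c a u)
  simp only [neg_mul, Finset.sum_neg_distrib] at f1 f2 f3 f4 f5 f6
  linarith
end
end
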